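/- Let λ ∈ ℂ with λ ≠ 0 and let φ : ℂ → ℂ be smooth with compact support. Set F := Tφ, i.e. F(z) = −(1/π) ∫_ℂ φ(ζ)/(ζ − z) dA(ζ). Then for every z ∈ ℂ the limit u(z) := −(1/π) e^{−λz + λ̄z̄} · lim_{r → ∞} ∫_{|ξ| ≤ r} e^{λξ − λ̄ξ̄} F(ξ)/(ξ̄ − z̄) dA(ξ) exists; the resulting function u is ℝ-differentiable on ℂ, satisfies ∂u/∂z + λ·u = F on ℂ, and consequently satisfies the Faddeev-type equation ∂/∂z̄ (∂u/∂z + λ·u) = φ on ℂ. -/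

import Mathlib

open MeasureTheory Complex Filter

/-- The Wirtinger derivative ∂f/∂z of a function f : ℂ → ℂ. -/
noncomputable def dz (f : ℂ → ℂ) (z : ℂ) : ℂ :=
  (1 / 2) * (fderiv ℝ f z 1 - Complex.I * fderiv ℝ f z Complex.I)

/-- The Wirtinger derivative ∂f/∂z̄ of a function f : ℂ → ℂ. -/
noncomputable def dbar (f : ℂ → ℂ) (z : ℂ) : ℂ :=
  (1 / 2) * (fderiv ℝ f z 1 + Complex.I * fderiv ℝ f z Complex.I)

theorem kernel_integrable : Integrable (fun η : ℂ => 1 / ‖η‖ * (1 / (1 + ‖η‖) ^ 2)) := by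
  have h := (integrable_fun_norm_addHaar (E := ℂ) (volume : Measure ℂ)
    (f := fun y : ℝ => 1 / y * (1 / (1 + y) ^ 2))).2
  refine h ?_
  have h2 : IntegrableOn (fun y : ℝ => (1 + y ^ 2)⁻¹) (Set.Ioi 0) :=
    integrable_inv_one_add_sq.integrableOn
  refine Integrable.mono' h2 (by fun_prop) ?_
  refine (ae_restrict_iff' measurableSet_Ioi).2 (Eventually.of_forall fun y hy => ?_)
  have hy : 0 < y := hy
  have : y ^ (Module.finrank ℝ ℂ - 1) • (1 / y * (1 / (1 + y) ^ 2)) = 1 / (1 + y) ^ 2 := by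
    simp [Complex.finrank_real_complex]
    field_simp
  rw [this, Real.norm_of_nonneg (by positivity), ← one_div]
  apply one_div_le_one_div_of_le (by positivity)
  nlinarith

theorem shift_bound {C R : ℝ} (hC : 0 ≤ C) (x η : ℂ) (hx : ‖x‖ ≤ R) :
    C / (1 + ‖x + η‖) ^ 2 ≤ C * (1 + R) ^ 2 * (1 / (1 + ‖η‖) ^ 2) := by
  have hR : 0 ≤ R := (norm_nonneg x).trans hx
  have h1 : 1 + ‖η‖ ≤ (1 + R) * (1 + ‖x + η‖) := by
    have : ‖η‖ ≤ ‖x + η‖ + ‖x‖ := by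
      have := norm_sub_le (x + η) x
      simpa using this
    nlinarith [norm_nonneg (x + η)]
  have h2 : (1 + ‖η‖) ^ 2 ≤ ((1 + R) * (1 + ‖x + η‖)) ^ 2 := by gcongr
  rw [mul_one_div, div_le_div_iff₀ (by positivity) (by positivity)]
  calc C * (1 + ‖η‖) ^ 2 ≤ C * ((1 + R) * (1 + ‖x + η‖)) ^ 2 := by gcongr
    _ = _ := by ring

theorem conv_integrable {E : Type*} [NormedAddCommGroup E] [NormedSpace ℝ E] [NormedSpace ℂ E]
    [SecondCountableTopology E]
    {k : ℂ → ℂ} (hk : Measurable k) (hkb : ∀ η, ‖k η‖ ≤ 1 / ‖η‖) {g : ℂ → E} {C : ℝ}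
    (hC : 0 ≤ C) (hg : Continuous g) (h0 : ∀ z, ‖g z‖ ≤ C / (1 + ‖z‖) ^ 2) (z : ℂ) :
    Integrable (fun η => k η • g (z + η)) := by
  refine Integrable.mono' (kernel_integrable.const_mul (C * (1 + ‖z‖) ^ 2)) ?_ ?_
  · exact hk.aestronglyMeasurable.smul (by fun_prop : Continuous fun η => g (z + η)).aestronglyMeasurable
  · refine Eventually.of_forall fun η => ?_
    rw [norm_smul]
    calc ‖k η‖ * ‖g (z + η)‖ ≤ (1 / ‖η‖) * (C * (1 + ‖z‖) ^ 2 * (1 / (1 + ‖η‖) ^ 2)) := by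
          gcongr
          · exact hkb η
          · exact (h0 _).trans (shift_bound hC z η le_rfl)
      _ = _ := by ring

theorem conv_hasFDerivAt {k : ℂ → ℂ} (hk : Measurable k) (hkb : ∀ η, ‖k η‖ ≤ 1 / ‖η‖)
    {g : ℂ → ℂ} {C : ℝ} (hC : 0 ≤ C) (hg : ContDiff ℝ 1 g)
    (h0 : ∀ z, ‖g z‖ ≤ C / (1 + ‖z‖) ^ 2)
    (h1 : ∀ z, ‖fderiv ℝ g z‖ ≤ C / (1 + ‖z‖) ^ 2) (z : ℂ) :
    HasFDerivAt (fun z => ∫ η, k η * g (z + η)) (∫ η, k η • fderiv ℝ g (z + η)) z := by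
  have hgc := hg.continuous
  have hdc : Continuous (fderiv ℝ g) := hg.continuous_fderiv one_ne_zero
  refine hasFDerivAt_integral_of_dominated_of_fderiv_le (𝕜 := ℝ) (s := Metric.ball z 1)
    (bound := fun η => C * (1 + (‖z‖ + 1)) ^ 2 * (1 / ‖η‖ * (1 / (1 + ‖η‖) ^ 2)))
    (F' := fun z η => k η • fderiv ℝ g (z + η))
    (Metric.ball_mem_nhds _ one_pos) ?_ ?_ ?_ ?_ ?_ ?_
  · exact Eventually.of_forall fun x => (conv_integrable hk hkb hC hgc h0 x).aestronglyMeasurable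
  · exact conv_integrable hk hkb hC hgc h0 z
  · exact (conv_integrable hk hkb hC hdc h1 z).aestronglyMeasurable
  · refine Eventually.of_forall fun η x hx => ?_
    have hx' : ‖x‖ ≤ ‖z‖ + 1 := by
      have := norm_sub_norm_le x z
      have h3 : ‖x - z‖ < 1 := by simpa [dist_eq_norm] using hx
      linarith
    rw [norm_smul]
    calc ‖k η‖ * ‖fderiv ℝ g (x + η)‖
        ≤ (1 / ‖η‖) * (C * (1 + (‖z‖ + 1)) ^ 2 * (1 / (1 + ‖η‖) ^ 2)) := by
          gcongr
          · exact hkb η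
          · exact (h1 _).trans (shift_bound hC x η hx')
      _ = _ := by ring
  · exact kernel_integrable.const_mul _
  · refine Eventually.of_forall fun η x hx => ?_
    have h := ((hg.differentiable one_ne_zero) (x + η)).hasFDerivAt
    have h2 : HasFDerivAt (fun x => g (x + η)) (fderiv ℝ g (x + η)) x :=
      (hasFDerivAt_comp_add_right η).2 h
    exact h2.const_mul (k η)

theorem conv_fderiv_apply {k : ℂ → ℂ} (hk : Measurable k) (hkb : ∀ η, ‖k η‖ ≤ 1 / ‖η‖)
    {g : ℂ → ℂ} {C : ℝ} (hC : 0 ≤ C) (hg : ContDiff ℝ 1 g)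
    (h0 : ∀ z, ‖g z‖ ≤ C / (1 + ‖z‖) ^ 2)
    (h1 : ∀ z, ‖fderiv ℝ g z‖ ≤ C / (1 + ‖z‖) ^ 2) (z v : ℂ) :
    fderiv ℝ (fun z => ∫ η, k η * g (z + η)) z v = ∫ η, k η * fderiv ℝ g (z + η) v := by
  rw [(conv_hasFDerivAt hk hkb hC hg h0 h1 z).fderiv]
  rw [ContinuousLinearMap.integral_apply
    (conv_integrable hk hkb hC (hg.continuous_fderiv one_ne_zero) h1 z)]
  simp

theorem clm_norm_le (L : ℂ →L[ℝ] ℂ) : ‖L‖ ≤ ‖L 1‖ + ‖L I‖ := by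
  refine L.opNorm_le_bound (by positivity) fun x => ?_
  have : L x = x.re • L 1 + x.im • L I := by
    rw [← map_smul, ← map_smul, ← map_add]
    congr 1
    apply Complex.ext <;> simp
  rw [this]
  refine (norm_add_le _ _).trans ?_
  rw [norm_smul, norm_smul]
  have h1 := Complex.abs_re_le_norm x
  have h2 := Complex.abs_im_le_norm x
  rw [Real.norm_eq_abs, Real.norm_eq_abs]
  nlinarith [norm_nonneg (L 1), norm_nonneg (L I)]
theorem clm_real_mul (L : ℂ →L[ℝ] ℂ) (ρ : ℝ) (w : ℂ) : L ((ρ : ℂ) * w) = (ρ : ℂ) * L w := by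
  simpa using L.map_smul ρ w

theorem expI_deriv (θ : ℝ) : HasDerivAt (fun θ : ℝ => Complex.exp (θ * I)) (I * Complex.exp (θ * I)) θ := by
  have h : HasDerivAt (fun θ : ℝ => (θ : ℂ) * I) I θ := by
    simpa using (Complex.ofRealCLM.hasDerivAt (x := θ)).mul_const I
  simpa [mul_comm] using h.cexp

/-- Cauchy-Pompeiu on a disc centred at the singularity. -/
theorem pompeiu_disc {G : ℂ → ℂ} (hG : ContDiff ℝ 1 G) (z : ℂ) {r : ℝ} (hr : 0 < r) :
    ∫ η in Metric.closedBall (0 : ℂ) r, ((starRingEnd ℂ) η)⁻¹ * dz G (z + η) =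
      -Real.pi * G z + (1 / 2) * ∫ θ in (-Real.pi)..Real.pi, G (z + r * Complex.exp (θ * I)) := by
  have hdc : Continuous (fderiv ℝ G) := hG.continuous_fderiv one_ne_zero
  have hGc := hG.continuous
  have hGd := hG.differentiable one_ne_zero
  set a : ℝ × ℝ → ℂ := fun p => fderiv ℝ G (z + p.1 * Complex.exp (p.2 * I)) (Complex.exp (p.2 * I))
    with ha
  set b : ℝ × ℝ → ℂ := fun p =>
    fderiv ℝ G (z + p.1 * Complex.exp (p.2 * I)) (I * Complex.exp (p.2 * I)) with hb
  have hac : Continuous a := by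
    apply Continuous.clm_apply <;> fun_prop
  have hbc : Continuous b := by
    apply Continuous.clm_apply <;> fun_prop
  set S : Set (ℝ × ℝ) := Set.Ioc 0 r ×ˢ Set.Ioo (-Real.pi) Real.pi with hS
  have hSK : S ⊆ Set.Icc 0 r ×ˢ Set.Icc (-Real.pi) Real.pi :=
    Set.prod_mono Set.Ioc_subset_Icc_self Set.Ioo_subset_Icc_self
  have hai : IntegrableOn a S :=
    (hac.continuousOn.integrableOn_compact (isCompact_Icc.prod isCompact_Icc)).mono_set hSK
  have hbi : IntegrableOn b S :=
    (hbc.continuousOn.integrableOn_compact (isCompact_Icc.prod isCompact_Icc)).mono_set hSK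
  have key : ∫ η in Metric.closedBall (0 : ℂ) r, ((starRingEnd ℂ) η)⁻¹ * dz G (z + η) =
      ∫ p in S, (1 / 2 : ℂ) * (a p - I * b p) := by
    rw [← integral_indicator measurableSet_closedBall, ← Complex.integral_comp_polarCoord_symm,
      polarCoord_target]
    have hT : MeasurableSet (Set.Ioi (0:ℝ) ×ˢ Set.Ioo (-Real.pi) Real.pi) :=
      measurableSet_Ioi.prod measurableSet_Ioo
    have hSm : MeasurableSet S := measurableSet_Ioc.prod measurableSet_Ioo
    rw [← integral_indicator hT, ← integral_indicator hSm]
    congr 1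
    ext p
    by_cases hp : p ∈ Set.Ioi (0:ℝ) ×ˢ Set.Ioo (-Real.pi) Real.pi
    · rw [Set.indicator_of_mem hp]
      have hp1 : 0 < p.1 := hp.1
      by_cases hpr : p.1 ≤ r
      · have hpS : p ∈ S := ⟨⟨hp1, hpr⟩, hp.2⟩
        rw [Set.indicator_of_mem hpS, Set.indicator_of_mem (by
          rw [mem_closedBall_zero_iff, Complex.norm_polarCoord_symm, abs_of_pos hp1]; exact hpr)]
        rw [Complex.polarCoord_symm_apply]
        have he : (Real.cos p.2 : ℂ) + Real.sin p.2 * I = Complex.exp (p.2 * I) := by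
          rw [Complex.exp_mul_I]; simp
        rw [he]
        have h0 : (p.1 : ℂ) ≠ 0 := by exact_mod_cast hp1.ne'
        simp only [ha, hb, dz]
        set L := fderiv ℝ G (z + p.1 * Complex.exp (p.2 * I))
        have hw : ∀ w : ℂ, L w = w.re * L 1 + w.im * L I := by
          intro w
          have : w = w.re • (1:ℂ) + w.im • I := by
            apply Complex.ext <;> simp
          conv_lhs => rw [this]
          rw [map_add, map_smul, map_smul]
          simp
        have h3 : L (Complex.exp (p.2 * I)) - I * L (I * Complex.exp (p.2 * I)) =
            Complex.exp (p.2 * I) * (L 1 - I * L I) := by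
          rw [hw (Complex.exp (p.2 * I)), hw (I * Complex.exp (p.2 * I)), ← he]
          simp
          ring_nf
          simp
        rw [h3]
        have h4 : (starRingEnd ℂ) (Complex.exp (p.2 * I)) * Complex.exp (p.2 * I) = 1 := by
          rw [Complex.conj_mul', Complex.norm_exp_ofReal_mul_I]; simp
        have h5 := left_ne_zero_of_mul_eq_one h4
        rw [map_mul, Complex.conj_ofReal, Complex.real_smul]
        field_simp
        linear_combination (-(L 1 - I * L I)) * h4
      · rw [Set.indicator_of_notMem, Set.indicator_of_notMem, smul_zero]
        · exact fun h => hpr h.1.2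
        · rw [mem_closedBall_zero_iff, Complex.norm_polarCoord_symm, abs_of_pos hp1]; exact hpr
    · rw [Set.indicator_of_notMem hp, Set.indicator_of_notMem]
      exact fun h => hp ⟨h.1.1, h.2⟩
  rw [key, integral_const_mul, integral_sub hai (hbi.const_mul I), integral_const_mul]
  have hB : ∫ p in S, b p = 0 := by
    rw [hS, Measure.volume_eq_prod, setIntegral_prod _ hbi]
    refine setIntegral_eq_zero_of_forall_eq_zero fun ρ hρ => ?_
    have hρ0 : (ρ : ℂ) ≠ 0 := by exact_mod_cast hρ.1.ne'
    rw [← integral_Ioc_eq_integral_Ioo, ← intervalIntegral.integral_of_le (by linarith [Real.pi_pos])]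
    have hd : ∀ θ ∈ Set.uIcc (-Real.pi) Real.pi,
        HasDerivAt (fun θ : ℝ => G (z + ρ * Complex.exp (θ * I))) (ρ * b (ρ, θ)) θ := by
      intro θ _
      have h := (hGd (z + ρ * Complex.exp (θ * I))).hasFDerivAt.comp_hasDerivAt θ
        (((expI_deriv θ).const_mul (ρ : ℂ)).const_add z)
      refine h.congr_deriv ?_
      change fderiv ℝ G _ ((ρ : ℂ) * (I * Complex.exp (θ * I))) = (ρ : ℂ) * fderiv ℝ G _ _
      exact clm_real_mul _ _ _
    have h := intervalIntegral.integral_eq_sub_of_hasDerivAt hd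
      (Continuous.intervalIntegrable (by fun_prop) _ _)
    rw [intervalIntegral.integral_const_mul] at h
    have h6 : (ρ:ℂ) * ∫ θ in (-Real.pi)..Real.pi, b (ρ, θ) = 0 := by
      rw [h]
      simp [Complex.exp_neg, Complex.exp_pi_mul_I]
    exact (mul_eq_zero.1 h6).resolve_left hρ0
  have hA : ∫ p in S, a p = (∫ θ in (-Real.pi)..Real.pi, G (z + r * Complex.exp (θ * I)))
      - 2 * Real.pi * G z := by
    rw [hS, Measure.volume_eq_prod, ← setIntegral_prod_swap, setIntegral_prod (fun q : ℝ × ℝ => a q.swap) hai.swap]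
    have : ∀ θ : ℝ, ∫ ρ in Set.Ioc 0 r, a (ρ, θ) = G (z + r * Complex.exp (θ * I)) - G z := by
      intro θ
      rw [← intervalIntegral.integral_of_le hr.le]
      have hd : ∀ ρ ∈ Set.uIcc 0 r,
          HasDerivAt (fun ρ : ℝ => G (z + ρ * Complex.exp (θ * I))) (a (ρ, θ)) ρ := by
        intro ρ _
        have h := (hGd (z + ρ * Complex.exp (θ * I))).hasFDerivAt.comp_hasDerivAt ρ
          (((Complex.ofRealCLM.hasDerivAt (x := ρ)).mul_const (Complex.exp (θ * I))).const_add z)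
        refine h.congr_deriv ?_
        simp [ha]
      rw [intervalIntegral.integral_eq_sub_of_hasDerivAt hd
        (Continuous.intervalIntegrable (by fun_prop) _ _)]
      simp
    simp only [Prod.swap, this]
    rw [← integral_Ioc_eq_integral_Ioo, ← intervalIntegral.integral_of_le (by linarith [Real.pi_pos])]
    rw [intervalIntegral.integral_sub (Continuous.intervalIntegrable (by fun_prop) _ _) (by simp)]
    simp
    left
    ring
  rw [hA, hB]
  ring

/-- limit version -/
theorem pompeiu_lim {G : ℂ → ℂ} (hG : ContDiff ℝ 1 G) {C : ℝ}
    (h0 : ∀ z, ‖G z‖ ≤ C / (1 + ‖z‖)) (z : ℂ) :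
    Tendsto (fun r : ℝ => ∫ η in Metric.closedBall (0 : ℂ) r,
      ((starRingEnd ℂ) η)⁻¹ * dz G (z + η)) atTop (nhds (-Real.pi * G z)) := by
  have hC : 0 ≤ C := by simpa using (norm_nonneg _).trans (h0 0)
  have h : Tendsto (fun r : ℝ => -Real.pi * G z + (1 / 2) *
      ∫ θ in (-Real.pi)..Real.pi, G (z + r * Complex.exp (θ * I))) atTop
      (nhds (-Real.pi * G z + (1 / 2) * 0)) := by
    refine tendsto_const_nhds.add (Tendsto.const_mul _ ?_)
    have hlim : Tendsto (fun r : ℝ => C / (1 + (r - ‖z‖)) * |Real.pi - -Real.pi|) atTop (nhds 0) := by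
      have : Tendsto (fun r : ℝ => C / (1 + (r - ‖z‖))) atTop (nhds 0) :=
        tendsto_const_nhds.div_atTop (tendsto_atTop_add_const_left _ _
          (tendsto_atTop_add_const_right _ _ tendsto_id))
      simpa using this.mul_const |Real.pi - -Real.pi|
    refine squeeze_zero_norm' ?_ hlim
    filter_upwards [eventually_gt_atTop ‖z‖] with r hr
    refine intervalIntegral.norm_integral_le_of_norm_le_const fun θ _ => ?_
    refine (h0 _).trans ?_
    have : r - ‖z‖ ≤ ‖z + r * Complex.exp (θ * I)‖ := by
      have h1 := norm_sub_le (z + r * Complex.exp (θ * I)) z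
      rw [add_sub_cancel_left, norm_mul, Complex.norm_exp_ofReal_mul_I, Complex.norm_real,
        mul_one, Real.norm_of_nonneg ((norm_nonneg z).trans hr.le)] at h1
      linarith
    have : 0 < 1 + (r - ‖z‖) := by linarith
    gcongr
  rw [mul_zero, add_zero] at h
  refine h.congr' ?_
  filter_upwards [eventually_gt_atTop 0] with r hr
  exact (pompeiu_disc hG z hr).symm

theorem dz_mul {f g : ℂ → ℂ} {z : ℂ} (hf : DifferentiableAt ℝ f z) (hg : DifferentiableAt ℝ g z) :
    dz (fun w => f w * g w) z = dz f z * g z + f z * dz g z := by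
  simp only [dz]
  rw [fderiv_fun_mul hf hg]
  simp
  ring

theorem dz_sub {f g : ℂ → ℂ} {z : ℂ} (hf : DifferentiableAt ℝ f z) (hg : DifferentiableAt ℝ g z) :
    dz (fun w => f w - g w) z = dz f z - dz g z := by
  simp only [dz]
  rw [fderiv_fun_sub hf hg]
  simp
  ring

theorem dz_const_mul {f : ℂ → ℂ} {z : ℂ} (c : ℂ) (hf : DifferentiableAt ℝ f z) :
    dz (fun w => c * f w) z = c * dz f z := by
  simp only [dz]
  rw [fderiv_const_mul hf]
  simp
  ring

theorem dbar_const_mul {f : ℂ → ℂ} {z : ℂ} (c : ℂ) (hf : DifferentiableAt ℝ f z) :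
    dbar (fun w => c * f w) z = c * dbar f z := by
  simp only [dbar]
  rw [fderiv_const_mul hf]
  simp
  ring

theorem dz_conj {f : ℂ → ℂ} {z : ℂ} (hf : DifferentiableAt ℝ f z) :
    dz (fun w => (starRingEnd ℂ) (f w)) z = (starRingEnd ℂ) (dbar f z) := by
  have h : HasFDerivAt (fun w => (starRingEnd ℂ) (f w))
      ((Complex.conjCLE : ℂ →L[ℝ] ℂ).comp (fderiv ℝ f z)) z :=
    (Complex.conjCLE : ℂ →L[ℝ] ℂ).hasFDerivAt.comp z hf.hasFDerivAt
  simp only [dz, dbar, h.fderiv]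
  have h2 : (starRingEnd ℂ) 2 = 2 := map_ofNat _ 2
  simp [h2]
  ring

theorem kbar_meas : Measurable (fun η : ℂ => ((starRingEnd ℂ) η)⁻¹) :=
  (Complex.continuous_conj.measurable).inv

theorem kbar_bound (η : ℂ) : ‖((starRingEnd ℂ) η)⁻¹‖ ≤ 1 / ‖η‖ := by
  simp

theorem k_bound (η : ℂ) : ‖η⁻¹‖ ≤ 1 / ‖η‖ := by
  simp

theorem dz_norm_le {g : ℂ → ℂ} {B : ℝ} {z : ℂ} (h1 : ‖fderiv ℝ g z‖ ≤ B) : ‖dz g z‖ ≤ B := by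
  have h2 := (fderiv ℝ g z).le_opNorm 1
  have h3 := (fderiv ℝ g z).le_opNorm I
  have h4 := norm_sub_le (fderiv ℝ g z 1) (I * fderiv ℝ g z I)
  simp only [norm_one, mul_one, Complex.norm_I] at h2 h3
  rw [norm_mul, Complex.norm_I, one_mul] at h4
  simp only [dz, norm_mul]
  norm_num
  linarith

theorem dz_continuous {g : ℂ → ℂ} (hg : ContDiff ℝ 1 g) : Continuous (dz g) := by
  have hdc : Continuous (fderiv ℝ g) := hg.continuous_fderiv one_ne_zero
  unfold dz
  fun_prop

theorem pompeiu_full {g : ℂ → ℂ} {C : ℝ} (hC : 0 ≤ C) (hg : ContDiff ℝ 1 g)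
    (h0 : ∀ z, ‖g z‖ ≤ C / (1 + ‖z‖) ^ 2)
    (h1 : ∀ z, ‖fderiv ℝ g z‖ ≤ C / (1 + ‖z‖) ^ 2) (z : ℂ) :
    ∫ η, ((starRingEnd ℂ) η)⁻¹ * dz g (z + η) = -Real.pi * g z := by
  have hi : Integrable (fun η => ((starRingEnd ℂ) η)⁻¹ * dz g (z + η)) :=
    conv_integrable kbar_meas kbar_bound hC (dz_continuous hg) (fun w => dz_norm_le (h1 w)) z
  have hlim := (aecover_closedBall (μ := (volume : Measure ℂ)) (x := (0:ℂ)) (tendsto_id (α := ℝ) (x := atTop))).integral_tendsto_of_countably_generated hi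
  refine tendsto_nhds_unique hlim (pompeiu_lim (C := C) hg (fun w => (h0 w).trans ?_) z)
  gcongr
  nlinarith [norm_nonneg w]

theorem conv_dz {g : ℂ → ℂ} {C : ℝ} (hC : 0 ≤ C) (hg : ContDiff ℝ 1 g)
    (h0 : ∀ z, ‖g z‖ ≤ C / (1 + ‖z‖) ^ 2)
    (h1 : ∀ z, ‖fderiv ℝ g z‖ ≤ C / (1 + ‖z‖) ^ 2)
    {k : ℂ → ℂ} (hk : Measurable k) (hkb : ∀ η, ‖k η‖ ≤ 1 / ‖η‖) (z : ℂ) :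
    dz (fun z => ∫ η, k η * g (z + η)) z = ∫ η, k η * dz g (z + η) := by
  have hdc : Continuous (fderiv ℝ g) := hg.continuous_fderiv one_ne_zero
  have hI : ∀ v : ℂ, Integrable (fun η => k η * fderiv ℝ g (z + η) v) := fun v => by
    have := (conv_integrable hk hkb hC hdc h1 z).apply_continuousLinearMap v
    simpa using this
  simp only [dz]
  rw [conv_fderiv_apply hk hkb hC hg h0 h1, conv_fderiv_apply hk hkb hC hg h0 h1,
    ← integral_const_mul, ← integral_sub (hI 1) ((hI I).const_mul I), ← integral_const_mul]
  congr 1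
  ext η
  ring

theorem conv_dbar {g : ℂ → ℂ} {C : ℝ} (hC : 0 ≤ C) (hg : ContDiff ℝ 1 g)
    (h0 : ∀ z, ‖g z‖ ≤ C / (1 + ‖z‖) ^ 2)
    (h1 : ∀ z, ‖fderiv ℝ g z‖ ≤ C / (1 + ‖z‖) ^ 2)
    {k : ℂ → ℂ} (hk : Measurable k) (hkb : ∀ η, ‖k η‖ ≤ 1 / ‖η‖) (z : ℂ) :
    dbar (fun z => ∫ η, k η * g (z + η)) z = ∫ η, k η * dbar g (z + η) := by
  have hdc : Continuous (fderiv ℝ g) := hg.continuous_fderiv one_ne_zero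
  have hI : ∀ v : ℂ, Integrable (fun η => k η * fderiv ℝ g (z + η) v) := fun v => by
    have := (conv_integrable hk hkb hC hdc h1 z).apply_continuousLinearMap v
    simpa using this
  simp only [dbar]
  rw [conv_fderiv_apply hk hkb hC hg h0 h1, conv_fderiv_apply hk hkb hC hg h0 h1,
    ← integral_const_mul, ← integral_add (hI 1) ((hI I).const_mul I), ← integral_const_mul]
  congr 1
  ext η
  ring

/-- test functions -/
def IsTest (ψ : ℂ → ℂ) : Prop := ContDiff ℝ (⊤ : ℕ∞) ψ ∧ HasCompactSupport ψ

theorem IsTest.deriv {ψ : ℂ → ℂ} (h : IsTest ψ) (v : ℂ) : IsTest (fun z => fderiv ℝ ψ z v) := by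
  refine ⟨?_, ?_⟩
  · exact (h.1.fderiv_right (m := (⊤ : ℕ∞)) (by simp)).clm_apply contDiff_const
  · exact h.2.fderiv_apply (𝕜 := ℝ) v

theorem IsTest.dz {ψ : ℂ → ℂ} (h : IsTest ψ) : IsTest (dz ψ) := by
  refine ⟨?_, ?_⟩
  · exact contDiff_const.mul ((h.deriv 1).1.sub (contDiff_const.mul (h.deriv I).1))
  · exact ((h.deriv 1).2.sub ((h.deriv I).2.mul_left (f := fun _ => I))).mul_left (f := fun _ => (1/2 : ℂ))

theorem IsTest.id_mul {ψ : ℂ → ℂ} (h : IsTest ψ) : IsTest (fun z => z * ψ z) :=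
  ⟨contDiff_id.mul h.1, h.2.mul_left (f := fun z : ℂ => z)⟩

theorem IsTest.integrable {ψ : ℂ → ℂ} (h : IsTest ψ) : Integrable ψ :=
  h.1.continuous.integrable_of_hasCompactSupport h.2

theorem compact_decay {E : Type*} [NormedAddCommGroup E] [NormedSpace ℝ E] {ψ : ℂ → E}
    (hc : Continuous ψ) (hs : HasCompactSupport ψ) :
    ∃ C : ℝ, 0 ≤ C ∧ ∀ z, ‖ψ z‖ ≤ C / (1 + ‖z‖) ^ 2 := by
  obtain ⟨C, hC⟩ := (hs.smul_left (f := fun z : ℂ => (1 + ‖z‖) ^ 2)).exists_bound_of_continuous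
    (by fun_prop : Continuous ((fun z : ℂ => (1 + ‖z‖) ^ 2) • ψ))
  refine ⟨C, (norm_nonneg _).trans (hC 0), fun z => ?_⟩
  have := hC z
  simp only [Pi.smul_apply', norm_smul] at this
  rw [Real.norm_of_nonneg (by positivity)] at this
  rw [le_div_iff₀ (by positivity)]
  linarith

theorem IsTest.decay {ψ : ℂ → ℂ} (h : IsTest ψ) : ∃ C : ℝ, 0 ≤ C ∧
    (∀ z, ‖ψ z‖ ≤ C / (1 + ‖z‖) ^ 2) ∧ (∀ z, ‖fderiv ℝ ψ z‖ ≤ C / (1 + ‖z‖) ^ 2) := by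
  obtain ⟨C₁, h1, h1'⟩ := compact_decay h.1.continuous h.2
  obtain ⟨C₂, h2, h2'⟩ := compact_decay (h.1.continuous_fderiv (by simp)) (h.2.fderiv (𝕜 := ℝ))
  refine ⟨C₁ + C₂, by positivity, fun z => (h1' z).trans ?_, fun z => (h2' z).trans ?_⟩
  · gcongr; linarith
  · gcongr; linarith

theorem IsTest.c1 {ψ : ℂ → ℂ} (h : IsTest ψ) : ContDiff ℝ 1 ψ := h.1.of_le (by norm_cast)

/-- Cauchy transform without the constant. -/
noncomputable def CT (ψ : ℂ → ℂ) (z : ℂ) : ℂ := ∫ η, η⁻¹ * ψ (z + η)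

theorem CT_eq (ψ : ℂ → ℂ) (z : ℂ) : ∫ ζ, ψ ζ / (ζ - z) = CT ψ z := by
  rw [CT, ← integral_add_left_eq_self _ z]
  congr 1
  ext η
  rw [add_sub_cancel_left, div_eq_mul_inv, mul_comm]

theorem CT_differentiable {ψ : ℂ → ℂ} (h : IsTest ψ) : Differentiable ℝ (CT ψ) := by
  obtain ⟨C, hC, h0, h1⟩ := h.decay
  exact fun z => (conv_hasFDerivAt measurable_inv k_bound hC h.c1 h0 h1 z).differentiableAt

theorem CT_fderiv {ψ : ℂ → ℂ} (h : IsTest ψ) (z v : ℂ) :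
    fderiv ℝ (CT ψ) z v = CT (fun w => fderiv ℝ ψ w v) z := by
  obtain ⟨C, hC, h0, h1⟩ := h.decay
  exact conv_fderiv_apply measurable_inv k_bound hC h.c1 h0 h1 z v

theorem CT_c1 {ψ : ℂ → ℂ} (h : IsTest ψ) : ContDiff ℝ 1 (CT ψ) := by
  rw [contDiff_one_iff_fderiv]
  refine ⟨CT_differentiable h, continuous_clm_apply.2 fun v => ?_⟩
  simp only [CT_fderiv h]
  exact (CT_differentiable (h.deriv v)).continuous

theorem CT_dz {ψ : ℂ → ℂ} (h : IsTest ψ) (z : ℂ) : dz (CT ψ) z = CT (dz ψ) z := by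
  obtain ⟨C, hC, h0, h1⟩ := h.decay
  exact conv_dz hC h.c1 h0 h1 measurable_inv k_bound z

theorem CT_dbar {ψ : ℂ → ℂ} (h : IsTest ψ) (z : ℂ) : dbar (CT ψ) z = -Real.pi * ψ z := by
  obtain ⟨C, hC, h0, h1⟩ := h.decay
  have h2 := conv_dbar hC h.c1 h0 h1 measurable_inv k_bound z
  change dbar (CT ψ) z = _ at h2
  rw [h2]
  have hd : Differentiable ℝ ψ := h.c1.differentiable one_ne_zero
  have hf : ∀ w, fderiv ℝ (fun w => (starRingEnd ℂ) (ψ w)) w =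
      (Complex.conjCLE : ℂ →L[ℝ] ℂ).comp (fderiv ℝ ψ w) := fun w =>
    ((Complex.conjCLE : ℂ →L[ℝ] ℂ).hasFDerivAt.comp w (hd w).hasFDerivAt).fderiv
  have h3 := pompeiu_full (g := fun w => (starRingEnd ℂ) (ψ w)) hC
    ((Complex.conjCLE : ℂ →L[ℝ] ℂ).contDiff.comp h.c1)
    (fun w => by rw [RCLike.norm_conj]; exact h0 w)
    (fun w => by
      rw [hf]
      refine (ContinuousLinearMap.opNorm_le_bound _ (norm_nonneg (fderiv ℝ ψ w)) fun x => ?_).trans (h1 w)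
      simpa using (fderiv ℝ ψ w).le_opNorm x) z
  have h4 := congrArg (starRingEnd ℂ) h3
  rw [← integral_conj] at h4
  simpa [dz_conj (hd _)] using h4

theorem CT_decay {ψ : ℂ → ℂ} (h : IsTest ψ) : ∃ C : ℝ, 0 ≤ C ∧ ∀ z, ‖CT ψ z‖ ≤ C / (1 + ‖z‖) := by
  obtain ⟨R, hR⟩ := h.2.isCompact.isBounded.subset_closedBall (0 : ℂ)
  set R' := max R 0 with hR'
  have hsupp : ∀ ζ, ψ ζ ≠ 0 → ‖ζ‖ ≤ R' := fun ζ hζ => by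
    have := hR (subset_tsupport ψ hζ)
    rw [mem_closedBall_zero_iff] at this
    exact this.trans (le_max_left _ _)
  have hR0 : 0 ≤ R' := le_max_right _ _
  obtain ⟨M, hM⟩ := (isCompact_closedBall (0 : ℂ) (2 * R' + 1)).exists_bound_of_continuousOn
    (CT_differentiable h).continuous.continuousOn
  have hM0 : 0 ≤ M := (norm_nonneg _).trans (hM 0 (by simp; linarith))
  set J := ∫ ζ, ‖ψ ζ‖ with hJ
  have hJ0 : 0 ≤ J := integral_nonneg fun _ => norm_nonneg _
  refine ⟨M * (2 * R' + 2) + 4 * J, by positivity, fun z => ?_⟩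
  rw [le_div_iff₀ (by positivity)]
  by_cases hz : ‖z‖ ≤ 2 * R' + 1
  · have := hM z (by simpa using hz)
    calc ‖CT ψ z‖ * (1 + ‖z‖) ≤ M * (2 * R' + 2) :=
          mul_le_mul this (by linarith) (by positivity) hM0
      _ ≤ _ := by linarith
  · push Not at hz
    have hz0 : 0 < ‖z‖ := by linarith
    have : ‖CT ψ z‖ ≤ J * (2 / ‖z‖) := by
      rw [← CT_eq, hJ, ← integral_mul_const]
      refine norm_integral_le_of_norm_le (h.integrable.norm.mul_const _) (Eventually.of_forall fun ζ => ?_)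
      by_cases hζ : ψ ζ = 0
      · simp [hζ]
      · have h1 := hsupp ζ hζ
        have h2 : ‖z‖ / 2 ≤ ‖ζ - z‖ := by
          have := norm_sub_norm_le z ζ
          rw [norm_sub_rev] at this
          linarith
        rw [norm_div, div_eq_mul_inv]
        gcongr
        rw [← one_div, div_le_div_iff₀ (by linarith) hz0]
        linarith
    calc ‖CT ψ z‖ * (1 + ‖z‖) ≤ J * (2 / ‖z‖) * (2 * ‖z‖) := by
          gcongr
          linarith
      _ = 4 * J := by field_simp; ring
      _ ≤ _ := by
        have : 0 ≤ M * (2 * R' + 2) := by positivity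
        linarith

theorem CT_decay_sq {ψ : ℂ → ℂ} (h : IsTest ψ) (hi : ∫ ζ, ψ ζ = 0) :
    ∃ C : ℝ, 0 ≤ C ∧ ∀ z, ‖CT ψ z‖ ≤ C / (1 + ‖z‖) ^ 2 := by
  obtain ⟨C₁, hC₁, h1⟩ := CT_decay h
  obtain ⟨C₂, hC₂, h2⟩ := CT_decay h.id_mul
  refine ⟨C₁ + C₂, by positivity, fun z => ?_⟩
  have key : CT (fun w => w * ψ w) z = z * CT ψ z := by
    obtain ⟨C, hC, h0, _⟩ := h.decay
    have hI : Integrable (fun η => η⁻¹ * ψ (z + η)) :=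
      conv_integrable measurable_inv k_bound hC h.1.continuous h0 z
    have hi2 : ∫ η, ψ (z + η) = 0 := by
      rw [integral_add_left_eq_self]; exact hi
    have : CT (fun w => w * ψ w) z = ∫ η, (z * (η⁻¹ * ψ (z + η)) + ψ (z + η)) := by
      refine integral_congr_ae ?_
      filter_upwards [compl_mem_ae_iff.2 (measure_singleton (0 : ℂ))] with η hη
      have : η ≠ 0 := hη
      field_simp
    rw [this, integral_add (hI.const_mul z) (h.integrable.comp_add_left z), hi2, add_zero,
      integral_const_mul]
    rfl
  have h3 := h2 z
  rw [key, norm_mul] at h3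
  have h4 := h1 z
  rw [le_div_iff₀ (by positivity)] at h3 h4 ⊢
  nlinarith

theorem integral_deriv_zero {ψ : ℂ → ℂ} (h : IsTest ψ) (v : ℂ) : ∫ ζ, fderiv ℝ ψ ζ v = 0 := by
  have := integral_mul_fderiv_eq_neg_fderiv_mul_of_integrable (μ := (volume : Measure ℂ))
    (f := fun _ : ℂ => (1 : ℂ)) (g := ψ) (v := v) (by simp) (by simpa using (h.deriv v).integrable)
    (by simpa using h.integrable) (fun x _ => differentiableAt_const _)
    (fun x _ => (h.c1.differentiable one_ne_zero) x)
  simpa using this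

theorem integral_dz_zero {ψ : ℂ → ℂ} (h : IsTest ψ) : ∫ ζ, dz ψ ζ = 0 := by
  simp only [dz]
  rw [integral_const_mul, integral_sub (h.deriv 1).integrable ((h.deriv I).integrable.const_mul I),
    integral_const_mul, integral_deriv_zero h, integral_deriv_zero h]
  simp

/-- the unimodular exponential -/
noncomputable def EE (l z : ℂ) : ℂ := Complex.exp (l * z - (starRingEnd ℂ) l * (starRingEnd ℂ) z)

theorem EE_norm (l z : ℂ) : ‖EE l z‖ = 1 := by
  rw [EE, Complex.norm_exp]
  simp

theorem EE_neg (l z : ℂ) : EE (-l) z * EE l z = 1 := by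
  rw [EE, EE, ← Complex.exp_add, ← Complex.exp_zero]
  congr 1
  simp

theorem EE_contDiff (l : ℂ) : ContDiff ℝ 1 (EE l) := by
  have h : ContDiff ℝ 1 (fun z : ℂ => (starRingEnd ℂ) z) := (Complex.conjCLE : ℂ →L[ℝ] ℂ).contDiff
  have h2 : ContDiff ℝ 1 (fun z : ℂ => l * z - (starRingEnd ℂ) l * (starRingEnd ℂ) z) :=
    (contDiff_const.mul contDiff_id).sub (contDiff_const.mul h)
  exact h2.cexp

theorem EE_fderiv (l z v : ℂ) :
    fderiv ℝ (EE l) z v = EE l z * (l * v - (starRingEnd ℂ) l * (starRingEnd ℂ) v) := by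
  have h : HasFDerivAt (fun z : ℂ => (starRingEnd ℂ) z) (Complex.conjCLE : ℂ →L[ℝ] ℂ) z :=
    (Complex.conjCLE : ℂ →L[ℝ] ℂ).hasFDerivAt
  have h2 := (((hasFDerivAt_id (𝕜 := ℝ) z).const_mul l).sub (h.const_mul ((starRingEnd ℂ) l))).cexp
  have h3 : HasFDerivAt (EE l) _ z := h2
  rw [h3.fderiv]
  simp [EE]

theorem EE_dz (l z : ℂ) : dz (EE l) z = l * EE l z := by
  simp only [dz, EE_fderiv]
  simp
  ring_nf
  simp
  ring

theorem shift_aux {q : ℂ → ℂ} {z : ℂ} {C : ℝ} (hC : 0 ≤ C)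
    (hq : ∀ ξ, ‖q ξ‖ ≤ C / (1 + ‖ξ‖) * (1 / ‖ξ - z‖))
    (hqi : ∀ r, IntegrableOn q (Metric.closedBall 0 r)) {A : ℝ → Set ℂ}
    (hAm : ∀ r, MeasurableSet (A r))
    (hA1 : ∀ r, Metric.closedBall 0 (r - ‖z‖) ⊆ A r)
    (hA2 : ∀ r, A r ⊆ Metric.closedBall 0 (r + ‖z‖)) :
    Tendsto (fun r => (∫ ξ in A r, q ξ) - ∫ ξ in Metric.closedBall 0 (r - ‖z‖), q ξ) atTop (nhds 0) := by
  have hlim : Tendsto (fun r : ℝ => 16 * C * Real.pi * ‖z‖ / r) atTop (nhds 0) :=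
    tendsto_const_nhds.div_atTop tendsto_id
  refine squeeze_zero_norm' ?_ hlim
  filter_upwards [eventually_gt_atTop (4 * ‖z‖), eventually_gt_atTop 0] with r hr hr0
  have hz := norm_nonneg z
  rw [← setIntegral_sdiff Metric.isClosed_closedBall.measurableSet ((hqi _).mono_set (hA2 r)) (hA1 r)]
  have hsub : A r \ Metric.closedBall 0 (r - ‖z‖) ⊆
      Metric.closedBall 0 (r + ‖z‖) \ Metric.closedBall 0 (r - ‖z‖) := Set.sdiff_subset_sdiff_left (hA2 r)
  have hss : Metric.closedBall (0:ℂ) (r - ‖z‖) ⊆ Metric.closedBall 0 (r + ‖z‖) :=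
    Metric.closedBall_subset_closedBall (by linarith)
  have hfin : volume (Metric.closedBall (0:ℂ) (r + ‖z‖) \ Metric.closedBall 0 (r - ‖z‖)) < ⊤ :=
    (measure_mono Set.sdiff_subset).trans_lt measure_closedBall_lt_top
  have hvol : ∀ s : ℝ, 0 ≤ s → volume.real (Metric.closedBall (0:ℂ) s) = Real.pi * s ^ 2 := by
    intro s hs
    rw [Measure.real, Complex.volume_closedBall]
    simp [ENNReal.toReal_ofReal hs, mul_comm]
  have hv : volume.real (A r \ Metric.closedBall 0 (r - ‖z‖)) ≤ 4 * Real.pi * r * ‖z‖ := by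
    refine (measureReal_mono hsub hfin.ne).trans ?_
    rw [measureReal_sdiff hss Metric.isClosed_closedBall.measurableSet measure_closedBall_lt_top.ne,
      hvol _ (by linarith), hvol _ (by linarith)]
    apply le_of_eq; ring
  have hb := norm_setIntegral_le_of_norm_le_const (μ := (volume : Measure ℂ)) (f := q)
    (s := A r \ Metric.closedBall 0 (r - ‖z‖)) (C := 4 * C / r ^ 2)
    ((measure_mono hsub).trans_lt hfin) (fun ξ hξ => by
      have h1 : r - ‖z‖ < ‖ξ‖ := by simpa using hξ.2
      have h2 : r / 2 ≤ ‖ξ - z‖ := by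
        have := norm_sub_norm_le ξ z
        linarith
      have h3 : r / 2 ≤ 1 + ‖ξ‖ := by linarith
      refine (hq ξ).trans ?_
      calc C / (1 + ‖ξ‖) * (1 / ‖ξ - z‖) ≤ C / (r / 2) * (1 / (r / 2)) := by gcongr
        _ = _ := by field_simp; ring)
  refine hb.trans ?_
  calc 4 * C / r ^ 2 * volume.real (A r \ Metric.closedBall 0 (r - ‖z‖))
      ≤ 4 * C / r ^ 2 * (4 * Real.pi * r * ‖z‖) := by gcongr
    _ = _ := by field_simp; ring

theorem local_integrable_conv {H : ℂ → ℂ} {C : ℝ} (hC : 0 ≤ C) (hH : Continuous H)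
    (h0 : ∀ z, ‖H z‖ ≤ C / (1 + ‖z‖)) (z : ℂ) (r : ℝ) :
    IntegrableOn (fun η => ((starRingEnd ℂ) η)⁻¹ * H (z + η)) (Metric.closedBall 0 r) := by
  refine Integrable.mono' ((kernel_integrable.const_mul (C * (1 + r) ^ 2)).integrableOn) ?_ ?_
  · exact (kbar_meas.aestronglyMeasurable.mul
      (by fun_prop : Continuous fun η => H (z + η)).aestronglyMeasurable)
  · refine (ae_restrict_iff' Metric.isClosed_closedBall.measurableSet).2
      (Eventually.of_forall fun η hη => ?_)
    have hη : ‖η‖ ≤ r := by simpa using hη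
    have h1 : ‖H (z + η)‖ ≤ C := (h0 _).trans (div_le_self hC (by linarith [norm_nonneg (z + η)]))
    have h2 : 1 ≤ (1 + r) ^ 2 * (1 / (1 + ‖η‖) ^ 2) := by
      rw [mul_one_div, one_le_div (by positivity)]
      gcongr
    rw [norm_mul]
    calc ‖((starRingEnd ℂ) η)⁻¹‖ * ‖H (z + η)‖ ≤ 1 / ‖η‖ * (C * ((1 + r) ^ 2 * (1 / (1 + ‖η‖) ^ 2))) := by
          gcongr
          · exact kbar_bound η
          · exact h1.trans (le_mul_of_one_le_right hC h2)
      _ = _ := by ring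

/-- balls centred at `z` can be replaced by balls centred at `0` -/
theorem shift_lim {H : ℂ → ℂ} {C : ℝ} (hC : 0 ≤ C) (hH : Continuous H)
    (h0 : ∀ z, ‖H z‖ ≤ C / (1 + ‖z‖)) (z a : ℂ)
    (hlim : Tendsto (fun r : ℝ => ∫ η in Metric.closedBall (0 : ℂ) r,
      ((starRingEnd ℂ) η)⁻¹ * H (z + η)) atTop (nhds a)) :
    Tendsto (fun r : ℝ => ∫ ξ in Metric.closedBall (0 : ℂ) r,
      H ξ / ((starRingEnd ℂ) ξ - (starRingEnd ℂ) z)) atTop (nhds a) := by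
  set q : ℂ → ℂ := fun ξ => H ξ / ((starRingEnd ℂ) ξ - (starRingEnd ℂ) z) with hqdef
  have hqz : ∀ η, q (z + η) = ((starRingEnd ℂ) η)⁻¹ * H (z + η) := fun η => by
    simp [hqdef, div_eq_mul_inv, mul_comm]
  have hind : ∀ r η, (Metric.closedBall z r).indicator q (z + η) =
      (Metric.closedBall 0 r).indicator (fun η => ((starRingEnd ℂ) η)⁻¹ * H (z + η)) η := by
    intro r η
    simp only [Set.indicator, mem_closedBall_iff_norm, add_sub_cancel_left, sub_zero, hqz]
  have hqi' : ∀ r, IntegrableOn q (Metric.closedBall z r) := fun r => by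
    rw [← integrable_indicator_iff Metric.isClosed_closedBall.measurableSet]
    have h1 := (integrable_indicator_iff Metric.isClosed_closedBall.measurableSet).2
      (local_integrable_conv hC hH h0 z r)
    have h2 := h1.comp_add_left (-z)
    refine h2.congr (Eventually.of_forall fun ξ => ?_)
    simp only [← hind]
    simp
  have hqi : ∀ r, IntegrableOn q (Metric.closedBall 0 r) := fun r =>
    (hqi' (r + ‖z‖)).mono_set (Metric.closedBall_subset_closedBall' (by simp))
  have hballs : ∀ r, ∫ ξ in Metric.closedBall z r, q ξ = ∫ η in Metric.closedBall (0 : ℂ) r,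
      ((starRingEnd ℂ) η)⁻¹ * H (z + η) := fun r => by
    rw [← integral_indicator Metric.isClosed_closedBall.measurableSet,
      ← integral_indicator Metric.isClosed_closedBall.measurableSet,
      ← integral_add_left_eq_self _ z]
    simp only [hind]
  have hq : ∀ ξ, ‖q ξ‖ ≤ C / (1 + ‖ξ‖) * (1 / ‖ξ - z‖) := fun ξ => by
    simp only [hqdef]
    rw [norm_div, ← map_sub, RCLike.norm_conj, div_eq_mul_one_div]
    gcongr
    exact h0 ξ
  have t1 := shift_aux hC hq hqi (A := fun r => Metric.closedBall z r)
    (fun r => Metric.isClosed_closedBall.measurableSet)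
    (fun r => Metric.closedBall_subset_closedBall' (by simp))
    (fun r => Metric.closedBall_subset_closedBall' (by simp))
  have t2 := shift_aux hC hq hqi (A := fun r => Metric.closedBall 0 r)
    (fun r => Metric.isClosed_closedBall.measurableSet)
    (fun r => Metric.closedBall_subset_closedBall (by linarith [norm_nonneg z]))
    (fun r => Metric.closedBall_subset_closedBall (by linarith [norm_nonneg z]))
  have t3 := (t2.sub t1).add hlim
  simp only [sub_zero, zero_add] at t3
  refine t3.congr fun r => ?_
  rw [hballs]
  ring

theorem g_bounds {ψ : ℂ → ℂ} (h : IsTest ψ) (hi : ∫ ζ, ψ ζ = 0) (l : ℂ) :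
    ∃ C : ℝ, 0 ≤ C ∧ (∀ z, ‖EE l z * CT ψ z‖ ≤ C / (1 + ‖z‖) ^ 2) ∧
      (∀ z, ‖fderiv ℝ (fun z => EE l z * CT ψ z) z‖ ≤ C / (1 + ‖z‖) ^ 2) := by
  obtain ⟨C₀, hC₀, h0⟩ := CT_decay_sq h hi
  obtain ⟨C₁, hC₁, h1⟩ := CT_decay_sq (h.deriv 1) (integral_deriv_zero h 1)
  obtain ⟨C₂, hC₂, h2⟩ := CT_decay_sq (h.deriv I) (integral_deriv_zero h I)
  refine ⟨C₀ + 4 * ‖l‖ * C₀ + C₁ + C₂, by positivity, fun z => ?_, fun z => ?_⟩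
  · rw [norm_mul, EE_norm, one_mul]
    refine (h0 z).trans ?_
    gcongr
    have : 0 ≤ 4 * ‖l‖ * C₀ := by positivity
    linarith
  · have hv : ∀ v : ℂ, ‖v‖ = 1 → ‖fderiv ℝ (fun z => EE l z * CT ψ z) z v‖ ≤
        ‖CT (fun w => fderiv ℝ ψ w v) z‖ + 2 * ‖l‖ * ‖CT ψ z‖ := by
      intro v hv
      rw [fderiv_fun_mul ((EE_contDiff l).differentiable one_ne_zero z) (CT_differentiable h z)]
      simp only [add_apply, smul_apply, smul_eq_mul,
        CT_fderiv h, EE_fderiv]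
      refine (norm_add_le _ _).trans ?_
      simp only [norm_mul, EE_norm, one_mul]
      have h3 := norm_sub_le (l * v) ((starRingEnd ℂ) l * (starRingEnd ℂ) v)
      simp only [norm_mul, RCLike.norm_conj, hv, mul_one] at h3
      nlinarith [norm_nonneg (CT ψ z)]
    refine (clm_norm_le _).trans ?_
    have e1 := hv 1 (by simp)
    have e2 := hv I (by simp)
    have f0 := mul_le_mul_of_nonneg_left (h0 z) (norm_nonneg l)
    have f1 := h1 z
    have f2 := h2 z
    have f3 : 0 ≤ C₀ / (1 + ‖z‖) ^ 2 := by positivity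
    calc _ ≤ C₀ / (1 + ‖z‖) ^ 2 + 4 * (‖l‖ * (C₀ / (1 + ‖z‖) ^ 2)) + C₁ / (1 + ‖z‖) ^ 2
          + C₂ / (1 + ‖z‖) ^ 2 := by linarith
      _ = _ := by ring


/-- Proposition 4 i) in the case V = ℂ: the operator R_λ ∘ R̂ produces a solution of
the Faddeev-type equation ∂̄(∂ + λ)u = φ. -/
theorem faddeev_equation_solution (l : ℂ) (hl : l ≠ 0) (φ : ℂ → ℂ)
    (hφ : ContDiff ℝ (⊤ : ℕ∞) φ) (hsupp : HasCompactSupport φ) (F : ℂ → ℂ)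
    (hF : ∀ z : ℂ, F z = -(1 / (Real.pi : ℂ)) * ∫ ζ : ℂ, φ ζ / (ζ - z)) :
    ∃ u : ℂ → ℂ,
      (∀ z : ℂ, Tendsto (fun r : ℝ =>
          -(1 / (Real.pi : ℂ)) *
            Complex.exp (-(l * z) + (starRingEnd ℂ) l * (starRingEnd ℂ) z) *
            ∫ ξ in Metric.closedBall (0 : ℂ) r,
              Complex.exp (l * ξ - (starRingEnd ℂ) l * (starRingEnd ℂ) ξ) * F ξ /
                ((starRingEnd ℂ) ξ - (starRingEnd ℂ) z))
          atTop (nhds (u z))) ∧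
      (∀ z : ℂ, DifferentiableAt ℝ u z) ∧
      (∀ z : ℂ, dz u z + l * u z = F z) ∧
      (∀ z : ℂ, dbar (fun w : ℂ => dz u w + l * u w) z = φ z) := by
  have hT : IsTest φ := ⟨hφ, hsupp⟩
  have hψ : IsTest (dz φ) := hT.dz
  set c : ℂ := -(1 / (Real.pi : ℂ)) with hc
  have hpi : (Real.pi : ℂ) ≠ 0 := by exact_mod_cast Real.pi_ne_zero
  have hFc : F = fun z => c * CT φ z := by
    ext z
    rw [hF, CT_eq]
  have hFd : Differentiable ℝ (CT φ) := CT_differentiable hT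
  set g : ℂ → ℂ := fun z => EE l z * CT (dz φ) z with hg
  have hEd : ∀ l, Differentiable ℝ (EE l) := fun l => (EE_contDiff l).differentiable one_ne_zero
  obtain ⟨C, hC, hg0, hg1⟩ := g_bounds hψ (integral_dz_zero hT) l
  have hgc : ContDiff ℝ 1 g := (EE_contDiff l).mul (CT_c1 hψ)
  set W : ℂ → ℂ := fun z => ∫ η, ((starRingEnd ℂ) η)⁻¹ * g (z + η) with hW
  have hWd : Differentiable ℝ W := fun z =>
    (conv_hasFDerivAt kbar_meas kbar_bound hC hgc hg0 hg1 z).differentiableAt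
  have hWdz : ∀ z, dz W z = -Real.pi * g z := fun z =>
    (conv_dz hC hgc hg0 hg1 kbar_meas kbar_bound z).trans (pompeiu_full hC hgc hg0 hg1 z)
  set H : ℂ → ℂ := fun z => EE l z * CT φ z with hH
  have hHc : ContDiff ℝ 1 H := (EE_contDiff l).mul (CT_c1 hT)
  obtain ⟨C', hC', hF0⟩ := CT_decay hT
  have hH0 : ∀ z, ‖H z‖ ≤ C' / (1 + ‖z‖) := fun z => by
    simp only [hH]
    rw [norm_mul, EE_norm, one_mul]
    exact hF0 z
  have hHdz : ∀ z, dz H z = l * H z + g z := fun z => by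
    simp only [hH, hg]
    rw [dz_mul (hEd l z) (hFd z), EE_dz, CT_dz hT]
    ring
  have hlim : ∀ z, Tendsto (fun r : ℝ => ∫ η in Metric.closedBall (0 : ℂ) r,
      ((starRingEnd ℂ) η)⁻¹ * H (z + η)) atTop (nhds (l⁻¹ * (-Real.pi * H z - W z))) := by
    intro z
    have t1 := pompeiu_lim hHc hH0 z
    have hgi : Integrable (fun η => ((starRingEnd ℂ) η)⁻¹ * g (z + η)) :=
      conv_integrable kbar_meas kbar_bound hC hgc.continuous hg0 z
    have t2 := (aecover_closedBall (μ := (volume : Measure ℂ)) (x := (0:ℂ))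
      (tendsto_id (α := ℝ) (x := atTop))).integral_tendsto_of_countably_generated hgi
    refine ((t1.sub t2).const_mul l⁻¹).congr fun r => ?_
    simp only [id]
    have hHi := local_integrable_conv hC' hHc.continuous hH0 z r
    rw [← integral_sub, ← integral_const_mul]
    · congr 1
      ext η
      rw [hHdz]
      field_simp
      ring
    · have : (fun η => ((starRingEnd ℂ) η)⁻¹ * dz H (z + η)) = fun η =>
          l * (((starRingEnd ℂ) η)⁻¹ * H (z + η)) + ((starRingEnd ℂ) η)⁻¹ * g (z + η) := by
        ext η
        rw [hHdz]
        ring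
      rw [this]
      exact (hHi.const_mul l).add hgi.integrableOn
    · exact hgi.integrableOn
  have hlim2 := fun z => shift_lim hC' hHc.continuous hH0 z _ (hlim z)
  have hexp : ∀ z, Complex.exp (-(l * z) + (starRingEnd ℂ) l * (starRingEnd ℂ) z) = EE (-l) z := by
    intro z
    rw [EE]
    congr 1
    simp
  have hdu : ∀ z, dz (fun z => l⁻¹ * (c * CT φ z - c ^ 2 * (EE (-l) z * W z))) z =
      c ^ 2 * (EE (-l) z * W z) := by
    intro z
    have d1 : DifferentiableAt ℝ (fun z => EE (-l) z * W z) z := (hEd (-l) z).mul (hWd z)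
    have d2 : DifferentiableAt ℝ (fun z => c ^ 2 * (EE (-l) z * W z)) z := d1.const_mul _
    have d3 : DifferentiableAt ℝ (fun z => c * CT φ z) z := (hFd z).const_mul _
    rw [dz_const_mul _ (d3.fun_sub d2), dz_sub d3 d2, dz_const_mul _ (hFd z), dz_const_mul _ d1,
      dz_mul (hEd (-l) z) (hWd z), EE_dz, hWdz, CT_dz hT]
    have e1 := EE_neg l z
    have e2 : c * Real.pi = -1 := by rw [hc]; field_simp
    simp only [hg]
    field_simp
    linear_combination (c ^ 2 * Real.pi * CT (dz φ) z) * e1 + c * CT (dz φ) z * e2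
  have hsol : ∀ z, dz (fun z => l⁻¹ * (c * CT φ z - c ^ 2 * (EE (-l) z * W z))) z +
      l * (l⁻¹ * (c * CT φ z - c ^ 2 * (EE (-l) z * W z))) = F z := by
    intro z
    rw [hdu, hFc]
    field_simp
    ring
  refine ⟨fun z => l⁻¹ * (c * CT φ z - c ^ 2 * (EE (-l) z * W z)), fun z => ?_, fun z => ?_, hsol,
    fun z => ?_⟩
  · have t := (hlim2 z).const_mul (c * EE (-l) z * c)
    have e1 := EE_neg l z
    have e2 : c * Real.pi = -1 := by rw [hc]; field_simp
    have hval : c * EE (-l) z * c * (l⁻¹ * (-Real.pi * H z - W z)) =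
        l⁻¹ * (c * CT φ z - c ^ 2 * (EE (-l) z * W z)) := by
      simp only [hH]
      linear_combination (-(l⁻¹ * c ^ 2 * Real.pi * CT φ z)) * e1 - l⁻¹ * c * CT φ z * e2
    rw [hval] at t
    refine t.congr fun r => ?_
    rw [hexp, mul_assoc (c * EE (-l) z), ← integral_const_mul]
    congr 2
    ext ξ
    rw [hFc]
    simp only [hH, EE]
    ring
  · exact (((hFd z).const_mul _).sub (((hEd (-l) z).mul (hWd z)).const_mul _)).const_mul _
  · simp only [hsol]
    rw [hFc]
    have := dbar_const_mul c (hFd z)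
    rw [this, CT_dbar hT, hc]
    field_simp
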